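/- arXiv:1909.10321 — 3 statements merged into one kernel-verified Lean document; each statement's English description precedes it below -/
import Mathlib

section
/- Let w > 0, a_L ≥ a_R, and d_L, d_R ≥ 0 with d_L + d_R ≤ w, and let δ be a real number with 0 ≤ δ ≤ min(d_L, d_R). Then the integral over [0, w] of the SP-function with parameters (a_L, a_R, d_L − δ, d_R − δ, w) equals the integral over [0, w] of the SP-function with parameters (a_L, a_R, d_L, d_R, w). (Thus the Case-1 straight-channel update, which shortens both flat segments by the increase in diffusion length while keeping the wall concentrations fixed, preserves the reactant mass.) -/
/-- The SP-function with parameters (a_L, a_R, d_L, d_R, w): constant a_L on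
[0, d_L], constant a_R on [w − d_R, w], and linearly decreasing from a_L to a_R
on the middle segment [d_L, w − d_R]. -/
noncomputable def SPfun (aL aR dL dR w : ℝ) : ℝ → ℝ := fun x =>
  if x ≤ dL then aL
  else if x < w - dR then aL + (aR - aL) * (x - dL) / (w - dL - dR)
  else aR

/-- The mass of an SP-function: two rectangles and a trapezoid. -/
theorem integral_SPfun (aL aR dL dR w : ℝ) (hdL : 0 ≤ dL) (hdR : 0 ≤ dR)
    (hsum : dL + dR ≤ w) :
    ∫ x in (0:ℝ)..w, SPfun aL aR dL dR w x
      = aL * dL + (aL + aR) / 2 * (w - dL - dR) + aR * dR := by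
  have left_eq : Set.EqOn (fun _ => aL) (SPfun aL aR dL dR w) (Set.uIoo 0 dL) := by
    intro x hx
    rw [Set.uIoo_of_le hdL] at hx
    simp [SPfun, hx.2.le]
  have middle_eq : Set.EqOn (fun x => aL + (aR - aL) / (w - dL - dR) * (x - dL))
      (SPfun aL aR dL dR w) (Set.uIoo dL (w - dR)) := by
    intro x hx
    rw [Set.uIoo_of_le (by linarith)] at hx
    simp only [SPfun, not_le.mpr hx.1, hx.2, if_true, if_false]
    ring
  have right_eq : Set.EqOn (fun _ => aR) (SPfun aL aR dL dR w) (Set.uIoo (w - dR) w) := by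
    intro x hx
    rw [Set.uIoo_of_le (by linarith)] at hx
    have hx' : dL < x := by linarith [hx.1]
    simp [SPfun, hx'.not_ge, hx.1.not_gt]
  have left_int : IntervalIntegrable (SPfun aL aR dL dR w) MeasureTheory.volume 0 dL :=
    intervalIntegrable_const.congr_uIoo left_eq
  have middle_int :
      IntervalIntegrable (SPfun aL aR dL dR w) MeasureTheory.volume dL (w - dR) :=
    (Continuous.intervalIntegrable (by fun_prop) _ _).congr_uIoo middle_eq
  have right_int : IntervalIntegrable (SPfun aL aR dL dR w) MeasureTheory.volume (w - dR) w :=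
    intervalIntegrable_const.congr_uIoo right_eq
  have middle_integral : ∫ x in dL..(w - dR), SPfun aL aR dL dR w x
      = (aL + aR) / 2 * (w - dL - dR) := by
    rw [← intervalIntegral.integral_congr_uIoo middle_eq,
      intervalIntegral.integral_add (by simp)
        (Continuous.intervalIntegrable (by fun_prop) _ _),
      intervalIntegral.integral_const_mul,
      intervalIntegral.integral_comp_sub_right (fun x => x), integral_id,
      intervalIntegral.integral_const, smul_eq_mul,
      show w - dR - dL = w - dL - dR by ring]
    rcases eq_or_ne (w - dL - dR) 0 with h | h
    · simp [h]
    · field_simp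
      ring
  rw [← intervalIntegral.integral_add_adjacent_intervals (left_int.trans middle_int) right_int,
    ← intervalIntegral.integral_add_adjacent_intervals left_int middle_int, middle_integral,
    ← intervalIntegral.integral_congr_uIoo left_eq,
    ← intervalIntegral.integral_congr_uIoo right_eq]
  simp only [intervalIntegral.integral_const, smul_eq_mul]
  ring

/-- The Case-1 straight-channel update, which shortens both flat segments of an
SP-function by the same amount δ while keeping the wall concentrations fixed,
preserves the reactant mass (the integral over [0, w]). -/
theorem stmt_5 (w aL aR dL dR δ : ℝ) (hw : 0 < w) (ha : aR ≤ aL)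
    (hdL : 0 ≤ dL) (hdR : 0 ≤ dR) (hsum : dL + dR ≤ w)
    (hδ0 : 0 ≤ δ) (hδ : δ ≤ min dL dR) :
    ∫ x in (0:ℝ)..w, SPfun aL aR (dL - δ) (dR - δ) w x
      = ∫ x in (0:ℝ)..w, SPfun aL aR dL dR w x := by
  have hδL : δ ≤ dL := hδ.trans (min_le_left _ _)
  have hδR : δ ≤ dR := hδ.trans (min_le_right _ _)
  rw [integral_SPfun _ _ _ _ _ (sub_nonneg.mpr hδL) (sub_nonneg.mpr hδR) (by linarith),
    integral_SPfun _ _ _ _ _ hdL hdR hsum]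
  ring
end

section
/- Let w > 0, a_L ≥ a_R, and let L, L' satisfy 0 < L ≤ L' ≤ w. Set a_R' = a_L − L·(a_L − a_R)/L'. Then a_R' ≤ a_L, and the integral over [0, w] of the SP-function with parameters (a_L, a_R', w − L', 0, w) equals the integral over [0, w] of the SP-function with parameters (a_L, a_R, w − L, 0, w). (Thus the Case-3 straight-channel update, which extends the middle segment to length L' and lowers the right-wall concentration to a_R', preserves the reactant mass.) -/
/-- The mass carried by an SP-function without right plateau, whose middle segment has length `L`. -/
theorem integral_SPfun_zero_right (w aL aR L : ℝ) (hL : 0 < L) (hLw : L ≤ w) :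
    ∫ x in (0:ℝ)..w, SPfun aL aR (w - L) 0 w x = aL * w - (aL - aR) * L / 2 := by
  have plateau : Set.EqOn (SPfun aL aR (w - L) 0 w) (fun _ => aL) (Set.uIcc 0 (w - L)) := by
    intro x hx
    rw [Set.uIcc_of_le (by linarith)] at hx
    simp [SPfun, hx.2]
  have slope : Set.EqOn (SPfun aL aR (w - L) 0 w)
      (fun x => aL + (aR - aL) / L * (x - (w - L))) (Set.uIcc (w - L) w) := by
    intro x hx
    rw [Set.uIcc_of_le (by linarith)] at hx
    obtain ⟨hx₁, hx₂⟩ := hx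
    simp only [SPfun, sub_zero, sub_sub_cancel]
    split_ifs with h₁ h₂
    · obtain rfl : x = w - L := le_antisymm h₁ hx₁
      simp
    · ring
    · obtain rfl : x = w := le_antisymm hx₂ (not_lt.mp h₂)
      field_simp
      ring
  have plateau_integrable : IntervalIntegrable (SPfun aL aR (w - L) 0 w) MeasureTheory.volume
      0 (w - L) :=
    (continuousOn_const.congr plateau).intervalIntegrable
  have slope_integrable : IntervalIntegrable (SPfun aL aR (w - L) 0 w) MeasureTheory.volume
      (w - L) w :=
    ((by fun_prop : Continuous fun x : ℝ =>
      aL + (aR - aL) / L * (x - (w - L))).continuousOn.congr slope).intervalIntegrable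
  rw [← intervalIntegral.integral_add_adjacent_intervals plateau_integrable slope_integrable,
    intervalIntegral.integral_congr plateau, intervalIntegral.integral_congr slope,
    intervalIntegral.integral_add (by simp) (Continuous.intervalIntegrable (by fun_prop) _ _),
    intervalIntegral.integral_const_mul,
    intervalIntegral.integral_comp_sub_right (fun x => x)]
  simp only [intervalIntegral.integral_const, integral_id, smul_eq_mul]
  field_simp
  ring

/-- The Case-3 straight-channel update, which extends the middle segment from
length L to length L' and lowers the right-wall concentration to
a_R' = a_L − L·(a_L − a_R)/L', preserves the reactant mass. -/
theorem stmt_6 (w aL aR L L' aR' : ℝ) (hw : 0 < w) (ha : aR ≤ aL)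
    (hL : 0 < L) (hLL' : L ≤ L') (hL'w : L' ≤ w)
    (haR' : aR' = aL - L * (aL - aR) / L') :
    aR' ≤ aL ∧
      ∫ x in (0:ℝ)..w, SPfun aL aR' (w - L') 0 w x
        = ∫ x in (0:ℝ)..w, SPfun aL aR (w - L) 0 w x := by
  have hL' : 0 < L' := hL.trans_le hLL'
  refine ⟨?_, ?_⟩
  · have : 0 ≤ L * (aL - aR) / L' := div_nonneg (mul_nonneg hL.le (sub_nonneg.mpr ha)) hL'.le
    linarith
  · rw [integral_SPfun_zero_right w aL aR' L' hL' hL'w,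
      integral_SPfun_zero_right w aL aR L hL (hLL'.trans hL'w), haR']
    field_simp
    ring
end

section
/- Let w > 0, a_L ≥ a_R, and d_L, d_R ≥ 0 with d_L + d_R ≤ w, let f be the SP-function with parameters (a_L, a_R, d_L, d_R, w), and let 0 < c < w. Then the rescaled left part g : [0, w] → ℝ defined by g(x) = f(c·x/w) is again an SP-function on [0, w]: there exist real numbers a_L' ≥ a_R' and d_L', d_R' ≥ 0 with d_L' + d_R' ≤ w such that g coincides on [0, w] with the SP-function with parameters (a_L', a_R', d_L', d_R', w). (Hence splitting a profile represented by an SP-function produces profiles that are again SP-functions.) -/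
/-- Splitting a profile represented by an SP-function produces profiles that
are again SP-functions: the rescaled left part x ↦ f(c·x/w) of an SP-function f
coincides on [0, w] with an SP-function. -/
theorem stmt_7 (w aL aR dL dR c : ℝ) (hw : 0 < w) (ha : aR ≤ aL)
    (hdL : 0 ≤ dL) (hdR : 0 ≤ dR) (hsum : dL + dR ≤ w)
    (hc0 : 0 < c) (hcw : c < w) :
    ∃ aL' aR' dL' dR' : ℝ, aR' ≤ aL' ∧ 0 ≤ dL' ∧ 0 ≤ dR' ∧ dL' + dR' ≤ w ∧
      ∀ x ∈ Set.Icc (0:ℝ) w,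
        SPfun aL aR dL dR w (c * x / w) = SPfun aL' aR' dL' dR' w x := by
  have hscale_le (x d : ℝ) : c * x / w ≤ d ↔ x ≤ d * w / c := by
    rw [div_le_iff₀ hw, le_div_iff₀ hc0, mul_comm c x]
  have hscale_lt (x d : ℝ) : c * x / w < d ↔ x < d * w / c := by
    rw [div_lt_iff₀ hw, lt_div_iff₀ hc0, mul_comm c x]
  rcases le_or_gt c dL with hcL | hcL
  · -- The cut lies in the left plateau: the left part is constant.
    refine ⟨aL, aL, w, 0, le_rfl, hw.le, le_rfl, by simp, fun x hx => ?_⟩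
    have hx' : c * x / w ≤ dL := by
      rw [div_le_iff₀ hw]
      nlinarith [hx.1, hx.2]
    simp [SPfun, hx', hx.2]
  have hdL' : 0 ≤ dL * w / c := by positivity
  rcases lt_or_ge c (w - dR) with hcR | hcR
  · -- The cut lies in the sloped segment: the right plateau disappears.
    have hm : 0 < w - dL - dR := by linarith
    have hcd : 0 < c - dL := by linarith
    have hdLw : dL * w / c < w := by
      rw [div_lt_iff₀ hc0]
      nlinarith
    refine ⟨aL, aL + (aR - aL) * (c - dL) / (w - dL - dR), dL * w / c, 0, ?_, hdL', le_rfl,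
      by linarith, fun x hx => ?_⟩
    · have : (aR - aL) * (c - dL) / (w - dL - dR) ≤ 0 :=
        div_nonpos_of_nonpos_of_nonneg
          (mul_nonpos_of_nonpos_of_nonneg (by linarith) hcd.le) hm.le
      linarith
    · have hx' : c * x / w < w - dR := by
        rw [div_lt_iff₀ hw]
        nlinarith [hx.1, hx.2]
      simp only [SPfun, hscale_le, hx', if_true, sub_zero]
      split_ifs with h₁ h₂
      · rfl
      · have hden : w - dL * w / c = (c - dL) * w / c := by field_simp
        rw [hden]
        field_simp
        ring
      · obtain rfl : x = w := le_antisymm hx.2 (not_lt.mp h₂)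
        rw [mul_div_cancel_right₀ _ hw.ne']
  · -- The cut lies in the right plateau: both breakpoints are rescaled.
    refine ⟨aL, aR, dL * w / c, w - (w - dR) * w / c, ha, hdL', ?_, ?_, fun x _ => ?_⟩
    · rw [sub_nonneg, div_le_iff₀ hc0]
      nlinarith
    · have : dL * w / c ≤ (w - dR) * w / c := by
        gcongr
        linarith
      linarith
    · simp only [SPfun, hscale_le, hscale_lt, sub_sub_cancel]
      split_ifs with h₁ h₂
      · rfl
      · have hlt := (div_lt_div_iff_of_pos_right hc0).mp ((not_le.mp h₁).trans h₂)
        have hm : 0 < w - dL - dR := by linarith [lt_of_mul_lt_mul_right hlt hw.le]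
        have hden : w - dL * w / c - (w - (w - dR) * w / c) = (w - dL - dR) * w / c := by
          field_simp
          ring
        rw [hden]
        field_simp
      · rfl
end
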